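/- Let S be the coordinate superalgebra of triples of even and pairs of odd generic skew-symmetric 7×7 matrices X₁,X₂,X₃, ψ₁,ψ₂, and let I_sc ⊆ S be the super-commuting ideal, as defined in the context. Then the explicit element Ξnc(X;ψ) ∈ S does not lie in I_sc; equivalently, Ξnc defines a nonzero element of the coordinate ring O(C^{3|2}_{so₇}) = S/I_sc of the super-commuting scheme of 3|2-tuples for so₇. -/

import Mathlib

/-!
Statement 1: the explicit non-Cartan element `Ξnc(X;ψ)` does not lie in the
super-commuting ideal `I_sc` of the coordinate superalgebra `S` of triples of
even and pairs of odd generic skew-symmetric 7×7 matrices.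
-/

open scoped TensorProduct

noncomputable section

/-- The index set of strictly-upper-triangular positions of a 7×7 matrix. -/
abbrev UpperPos : Type := {p : Fin 7 × Fin 7 // p.1 < p.2}

/-- The coordinate superalgebra `S` of three even and two odd generic
skew-symmetric 7×7 matrices. -/
abbrev SAlg : Type :=
  MvPolynomial (Fin 3 × UpperPos) ℂ ⊗[ℂ] ExteriorAlgebra ℂ (Fin 2 × UpperPos → ℂ)

/-- The generic even skew-symmetric matrices `X_i`. -/
def Xgen (i : Fin 3) : Matrix (Fin 7) (Fin 7) SAlg :=
  Matrix.of fun r s =>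
    if h : r < s then MvPolynomial.X (i, ⟨(r, s), h⟩) ⊗ₜ[ℂ] 1
    else if h' : s < r then -(MvPolynomial.X (i, ⟨(s, r), h'⟩) ⊗ₜ[ℂ] 1)
    else 0

/-- The odd exterior generator `e(α,p)`. -/
def eGen (α : Fin 2) (p : UpperPos) : SAlg :=
  (1 : MvPolynomial (Fin 3 × UpperPos) ℂ) ⊗ₜ[ℂ]
    ExteriorAlgebra.ι ℂ (Pi.single (α, p) (1 : ℂ))

/-- The generic odd skew-symmetric matrices `ψ_α`. -/
def psiGen (α : Fin 2) : Matrix (Fin 7) (Fin 7) SAlg :=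
  Matrix.of fun r s =>
    if h : r < s then eGen α ⟨(r, s), h⟩
    else if h' : s < r then -eGen α ⟨(s, r), h'⟩
    else 0

/-- The totally antisymmetric symbol on `Fin 3` with `ε(0,1,2) = 1`. -/
def eps (i j k : Fin 3) : ℤ :=
  (((j : ℤ) - (i : ℤ)) * ((k : ℤ) - (i : ℤ)) * ((k : ℤ) - (j : ℤ))) / 2

/-- The explicit non-Cartan element `Ξnc(X;ψ)`, defined for 7×7 matrices over any
ring `Λ` that is an algebra over a commutative ℂ-algebra `R` (here
`S_{il} := (X_i X_l + X_l X_i)/2`). -/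
def XiNC {R Λ : Type} [CommRing R] [Algebra ℂ R] [Ring Λ] [Algebra R Λ]
    (X : Fin 3 → Matrix (Fin 7) (Fin 7) Λ) (ψ : Fin 2 → Matrix (Fin 7) (Fin 7) Λ) : Λ :=
  ∑ i : Fin 3, ∑ j : Fin 3, ∑ k : Fin 3, ∑ l : Fin 3, ∑ m : Fin 3, ∑ n : Fin 3,
    (eps i j k * eps l m n) •
      ((Matrix.trace (X i * X l) *
          (Matrix.trace (ψ 0 * ψ 1) - Matrix.trace (ψ 1 * ψ 0))
        - (Matrix.trace (X i * ψ 0) * Matrix.trace (X l * ψ 1)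
            - Matrix.trace (X i * ψ 1) * Matrix.trace (X l * ψ 0))
        - 4 * (Matrix.trace (ψ 0 * ψ 1 *
                (algebraMap ℂ R (1/2 : ℂ) • (X i * X l + X l * X i)))
              - Matrix.trace (ψ 1 * ψ 0 *
                (algebraMap ℂ R (1/2 : ℂ) • (X i * X l + X l * X i)))))
        * Matrix.trace (X j * X m) * Matrix.trace (X k * X n))

/-- The super-commuting ideal `I_sc ⊆ S`: the two-sided ideal generated by all
matrix entries of `X_iX_j − X_jX_i` (`i < j`), `X_iψ_α − ψ_αX_i`, and
`ψ_αψ_β + ψ_βψ_α` (`α ≤ β`). -/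
def Isc : TwoSidedIdeal SAlg :=
  TwoSidedIdeal.span
    ({x | ∃ (i j : Fin 3) (r s : Fin 7), i < j ∧
        x = (Xgen i * Xgen j - Xgen j * Xgen i) r s} ∪
     {x | ∃ (i : Fin 3) (α : Fin 2) (r s : Fin 7),
        x = (Xgen i * psiGen α - psiGen α * Xgen i) r s} ∪
     {x | ∃ (α β : Fin 2) (r s : Fin 7), α ≤ β ∧
        x = (psiGen α * psiGen β + psiGen β * psiGen α) r s})

/-- A letter `(α, a, b)` stands for the odd vector `e(α, a, b) - e(α, b, a)`. -/
abbrev Letter := Fin 2 × Fin 7 × Fin 7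

/-- A word of letters together with the free labels and indices of a quadratic relation. -/
abbrev Term := (Fin 2 × Fin 2) × (Fin 7 × Fin 7) × List Letter

/-- All ways to pull a letter of a word to the front, with the resulting sign. -/
def picks {A : Type*} : List A → List (ℤ × A × List A)
  | [] => []
  | l :: w => (1, l, w) :: (picks w).map fun t => (-t.1, t.2.1, l :: t.2.2)

/-- The contractions of two letters along one common index. -/
def glue (m l : Letter) (w : List Letter) : List (ℤ × Term) :=
  (if m.2.2 = l.2.1 then [(1, (m.1, l.1), (m.2.1, l.2.2), w)] else []) ++
  ((if m.2.2 = l.2.2 then [(-1, (m.1, l.1), (m.2.1, l.2.1), w)] else []) ++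
  ((if m.2.1 = l.2.1 then [(-1, (m.1, l.1), (m.2.2, l.2.2), w)] else []) ++
  (if m.2.1 = l.2.2 then [(1, (m.1, l.1), (m.2.2, l.2.1), w)] else [])))

/-- The terms of a quadratic contraction of a word. -/
def quadTerms (w : List Letter) : List (ℤ × Term) :=
  (picks w).flatMap fun s => (picks s.2.2).flatMap fun t =>
    (glue t.2.1 s.2.1 t.2.2).map fun u => (s.1 * t.1 * u.1, u.2)

def letterCode (l : Letter) : ℕ := (l.1.val * 7 + l.2.1.val) * 7 + l.2.2.val

/-- Insertion of a letter in a word, with the resulting sign. -/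
def insertLetter (l : Letter) : List Letter → ℤ × List Letter
  | [] => (1, [l])
  | m :: w =>
    if letterCode l ≤ letterCode m then (1, l :: m :: w)
    else ((-(insertLetter l w).1), m :: (insertLetter l w).2)

/-- Orients all letters and sorts them, with the resulting sign. -/
def sortWord : List Letter → ℤ × List Letter
  | [] => (1, [])
  | l :: w =>
    if l.2.1 ≤ l.2.2 then
      ((sortWord w).1 * (insertLetter l (sortWord w).2).1, (insertLetter l (sortWord w).2).2)
    else
      (-((sortWord w).1 * (insertLetter (l.1, l.2.2, l.2.1) (sortWord w).2).1),
        (insertLetter (l.1, l.2.2, l.2.1) (sortWord w).2).2)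

def relabel (k : Fin 2) (f : Fin 7 → Fin 7) (l : Letter) : Letter := (l.1 + k, f l.2.1, f l.2.2)

def relabelTerm (k : Fin 2) (f : Fin 7 → Fin 7) (t : Term) : Term :=
  ((t.1.1 + k, t.1.2 + k), (f t.2.1.1, f t.2.1.2), t.2.2.map (relabel k f))

def wordCode : List Letter → ℕ
  | [] => 0
  | l :: w => wordCode w * 98 + (letterCode l + 1)

def termCode (t : Term) : ℕ :=
  ((wordCode t.2.2 * 7 + t.2.1.1.val) * 7 + t.2.1.2.val) * 4 +
    if t.1.1 ≤ t.1.2 then t.1.1.val * 2 + t.1.2.val else t.1.2.val * 2 + t.1.1.val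

def digit (n : ℕ) (i : Fin 7) : Fin 7 := Fin.ofNat 7 (Nat.div n (Nat.pow 7 i.val))

def normalTerm (s : ℤ) (t : Term) : ℤ × ℕ :=
  (s * (sortWord t.2.2).1, termCode (t.1, t.2.1, (sortWord t.2.2).2))

/-- The number with base eight digits the cardinalities of the fibres. -/
def indexMask (f : Fin 7 → Fin 7) : ℕ :=
  Nat.pow 8 (f 0) + Nat.pow 8 (f 1) + Nat.pow 8 (f 2) + Nat.pow 8 (f 3) + Nat.pow 8 (f 4) +
    Nat.pow 8 (f 5) + Nat.pow 8 (f 6)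

/-- Normalizes a term after the relabelling encoded by `n`: seven base-seven digits of a
permutation, then a shift of the labels, then a flag for terms that equal their own negative. -/
def certify (n : ℕ) (s : ℤ) (t : Term) : ℤ × ℕ :=
  if indexMask (digit n) = 299593 then
    if 1647086 ≤ n then
      if (normalTerm 1 t).2 =
          (normalTerm 1 (relabelTerm (Fin.ofNat 2 (n / 823543)) (digit n) t)).2 ∧
        (normalTerm 1 t).1 = -(normalTerm 1 (relabelTerm (Fin.ofNat 2 (n / 823543)) (digit n) t)).1
      then (0, 0) else normalTerm s t
    else normalTerm s (relabelTerm (Fin.ofNat 2 (n / 823543)) (digit n) t)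
  else normalTerm s t

/-- Adds a multiple of a generator to a formal sum. -/
def addTerm (s : ℤ) (n : ℕ) : List (ℤ × ℕ) → List (ℤ × ℕ)
  | [] => [(s, n)]
  | t :: w => bif Nat.beq n t.2 then (s + t.1, n) :: w else t :: addTerm s n w

def collected : List (ℤ × Term) → List ℕ → List (ℤ × ℕ) → List (ℤ × ℕ)
  | [], _, acc => acc
  | t :: ts, cs, acc => collected ts cs.tail
      (addTerm (certify (cs.headD 0) t.1 t.2).1 (certify (cs.headD 0) t.1 t.2).2 acc)

section Abstract

set_option linter.unusedSectionVars false

variable {Λ : Type} [Ring Λ] [Algebra ℂ Λ]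

/-- The index set of odd generators: entries of two matrices and six further variables. -/
abbrev OddIndex := Letter ⊕ (Fin 3 × Fin 2)

/-- Odd elements of `Λ` that generate a super-commuting pair of skew matrices. -/
structure IsSuperPair (o : OddIndex → Λ) : Prop where
  anticomm : ∀ i j, o i * o j = -(o j * o i)
  skew : ∀ α a b, o (.inl (α, b, a)) = -o (.inl (α, a, b))
  rel : ∀ α β a b, ∑ k, (o (.inl (α, a, k)) * o (.inl (β, k, b)) +
    o (.inl (β, a, k)) * o (.inl (α, k, b))) = 0

def oddMat (o : OddIndex → Λ) (α : Fin 2) : Matrix (Fin 7) (Fin 7) Λ :=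
  Matrix.of fun a b => o (.inl (α, a, b))

def evenMat (o : OddIndex → Λ) (i : Fin 3) : Matrix (Fin 7) (Fin 7) Λ :=
  o (.inr (i, 0)) • oddMat o 0 + o (.inr (i, 1)) • oddMat o 1

def pairing (o : OddIndex → Λ) (i l : Fin 3) : Λ :=
  o (.inr (i, 0)) * o (.inr (l, 1)) - o (.inr (i, 1)) * o (.inr (l, 0))

def pairingSum (o : OddIndex → Λ) : Λ :=
  ∑ i : Fin 3, ∑ j : Fin 3, ∑ k : Fin 3, ∑ l : Fin 3, ∑ m : Fin 3, ∑ n : Fin 3,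
    (eps i j k * eps l m n) • (pairing o i l * pairing o j m * pairing o k n)

def traceForm (o : OddIndex → Λ) : Λ := Matrix.trace (oddMat o 0 * oddMat o 1)

lemma eq_zero_of_eq_neg {M : Type*} [AddCommGroup M] [Module ℂ M] {x : M} (h : x = -x) : x = 0 := by
  have h2 : (2 : ℂ) • x = 0 := by rw [two_smul]; nth_rewrite 1 [h]; simp
  simpa using h2

namespace IsSuperPair

variable {o : OddIndex → Λ} (h : IsSuperPair o)
include h

lemma commute_mul (i j k : OddIndex) : Commute (o i * o j) (o k) := by
  unfold Commute SemiconjBy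
  rw [mul_assoc, h.anticomm j k, mul_neg, ← mul_assoc, h.anticomm i k, neg_mul, neg_neg, mul_assoc]

lemma mat_mul_smul (α : Fin 2) (i : Fin 3 × Fin 2) (M : Matrix (Fin 7) (Fin 7) Λ) :
    oddMat o α * (o (.inr i) • M) = -(o (.inr i) • (oddMat o α * M)) := by
  ext a b
  simp only [Matrix.mul_apply, Matrix.smul_apply, Matrix.neg_apply, smul_eq_mul, Finset.mul_sum,
    ← Finset.sum_neg_distrib, oddMat, Matrix.of_apply]
  refine Finset.sum_congr rfl fun k _ => ?_
  rw [← mul_assoc, h.anticomm, neg_mul, mul_assoc]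

lemma mat_rel (α β : Fin 2) : oddMat o α * oddMat o β + oddMat o β * oddMat o α = 0 := by
  ext a b
  simpa [Matrix.mul_apply, oddMat, Finset.sum_add_distrib] using h.rel α β a b

lemma mat_sq (α : Fin 2) : oddMat o α * oddMat o α = 0 :=
  eq_zero_of_eq_neg (eq_neg_of_add_eq_zero_left (h.mat_rel α α))

lemma mat_anticomm : oddMat o 1 * oddMat o 0 = -(oddMat o 0 * oddMat o 1) :=
  eq_neg_of_add_eq_zero_left (h.mat_rel 1 0)

lemma even_mul_even (i l : Fin 3) :
    evenMat o i * evenMat o l = -(pairing o i l • (oddMat o 0 * oddMat o 1)) := by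
  simp only [evenMat, pairing, add_mul, mul_add, Matrix.smul_mul, h.mat_mul_smul, h.mat_sq,
    h.mat_anticomm, smul_smul, smul_neg, sub_smul]
  simp
  abel

lemma even_mul_odd_zero (i : Fin 3) :
    evenMat o i * oddMat o 0 = -(o (.inr (i, 1)) • (oddMat o 0 * oddMat o 1)) := by
  simp [evenMat, add_mul, h.mat_sq, h.mat_anticomm]

lemma even_mul_odd_one (i : Fin 3) :
    evenMat o i * oddMat o 1 = o (.inr (i, 0)) • (oddMat o 0 * oddMat o 1) := by
  simp [evenMat, add_mul, h.mat_sq]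

lemma odd_zero_mul_even (i : Fin 3) :
    oddMat o 0 * evenMat o i = -(o (.inr (i, 1)) • (oddMat o 0 * oddMat o 1)) := by
  simp [evenMat, mul_add, h.mat_mul_smul, h.mat_sq]

lemma odd_one_mul_even (i : Fin 3) :
    oddMat o 1 * evenMat o i = o (.inr (i, 0)) • (oddMat o 0 * oddMat o 1) := by
  simp [evenMat, mul_add, h.mat_mul_smul, h.mat_sq, h.mat_anticomm]

lemma pairing_symm (i l : Fin 3) : pairing o i l = pairing o l i := by
  rw [pairing, pairing, h.anticomm (.inr (i, 0)), h.anticomm (.inr (i, 1))]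
  abel

lemma commute_traceForm (k : OddIndex) : Commute (traceForm o) (o k) := by
  simp only [traceForm, Matrix.trace, Matrix.diag, Matrix.mul_apply]
  exact Commute.sum_left _ _ _ fun _ _ => Commute.sum_left _ _ _ fun _ _ => h.commute_mul _ _ _

lemma commute_traceForm_pairing (i l : Fin 3) : Commute (traceForm o) (pairing o i l) :=
  ((h.commute_traceForm _).mul_right (h.commute_traceForm _)).sub_right
    ((h.commute_traceForm _).mul_right (h.commute_traceForm _))

lemma odd_mul_pairing_smul (α : Fin 2) (i l : Fin 3) (M : Matrix (Fin 7) (Fin 7) Λ) :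
    oddMat o α * (pairing o i l • M) = pairing o i l • (oddMat o α * M) := by
  simp [pairing, sub_smul, ← smul_smul, mul_sub, h.mat_mul_smul]

lemma XiNC_eq : XiNC (R := ℂ) (evenMat o) (oddMat o) =
    (-3 : ℤ) • (pairingSum o * traceForm o ^ 4) := by
  have h0 : oddMat o 0 * (oddMat o 1 * (oddMat o 0 * oddMat o 1)) = 0 := by
    rw [← mul_assoc (oddMat o 1), h.mat_anticomm, neg_mul, mul_assoc, h.mat_sq]; simp
  simp only [XiNC, pairingSum, Finset.sum_mul, Finset.smul_sum]
  refine Finset.sum_congr rfl fun i _ => Finset.sum_congr rfl fun j _ =>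
    Finset.sum_congr rfl fun k _ => Finset.sum_congr rfl fun l _ =>
    Finset.sum_congr rfl fun m _ => Finset.sum_congr rfl fun n _ => ?_
  rw [smul_mul_assoc, smul_comm (-3 : ℤ)]
  congr 1
  have hg (k : OddIndex) (x : Λ) : traceForm o * (o k * x) = o k * (traceForm o * x) := by
    rw [← mul_assoc, (h.commute_traceForm k).eq, mul_assoc]
  have hp (i l : Fin 3) (x : Λ) :
      traceForm o * (pairing o i l * x) = pairing o i l * (traceForm o * x) := by
    rw [← mul_assoc, (h.commute_traceForm_pairing i l).eq, mul_assoc]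
  have ht : (oddMat o 0 * oddMat o 1).trace = traceForm o := rfl
  simp only [h.even_mul_even, h.even_mul_odd_zero, h.even_mul_odd_one, h.mat_anticomm,
    h.pairing_symm l i, mul_assoc, Matrix.mul_add, Matrix.mul_smul, neg_mul,
    h.odd_mul_pairing_smul, h0, Matrix.trace_neg, Matrix.trace_smul, Matrix.trace_zero,
    smul_eq_mul, smul_zero, neg_zero, add_zero, sub_zero, mul_zero, ht, mul_neg, neg_neg, hg,
    sub_neg_eq_add]
  have hb : -(pairing o i l * (traceForm o * (traceForm o + traceForm o))) -
      (-(o (.inr (i, 1)) * (o (.inr (l, 0)) * (traceForm o * traceForm o))) +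
        o (.inr (i, 0)) * (o (.inr (l, 1)) * (traceForm o * traceForm o))) =
      (-3 : ℤ) • (pairing o i l * (traceForm o * traceForm o)) := by
    simp only [pairing, sub_mul, mul_add, mul_assoc]
    abel
  rw [hb]
  simp only [smul_mul_assoc, mul_assoc, hp, pow_succ, pow_zero, one_mul]

end IsSuperPair
end Abstract

section Hom

set_option linter.unusedSectionVars false

variable {Λ : Type} [Ring Λ] [Algebra ℂ Λ]

open scoped IsMulCommutative in
lemma exists_aeval_of_commute {σ : Type} (x : σ → Λ) (hx : ∀ i j, Commute (x i) (x j)) :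
    ∃ f : MvPolynomial σ ℂ →ₐ[ℂ] Λ, ∀ i, f (MvPolynomial.X i) = x i := by
  have := Algebra.isMulCommutative_adjoin ℂ (s := Set.range x)
    (by rintro _ ⟨i, rfl⟩ _ ⟨j, rfl⟩; exact hx i j)
  refine ⟨(Algebra.adjoin ℂ (Set.range x)).val.comp
    (MvPolynomial.aeval fun i => ⟨x i, Algebra.subset_adjoin ⟨i, rfl⟩⟩), fun i => ?_⟩
  simp

lemma commute_of_commute_X {σ : Type} (f : MvPolynomial σ ℂ →ₐ[ℂ] Λ) (y : Λ)
    (hf : ∀ i, Commute (f (MvPolynomial.X i)) y) (p : MvPolynomial σ ℂ) : Commute (f p) y := by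
  induction p using MvPolynomial.induction_on with
  | C a =>
    rw [← MvPolynomial.algebraMap_eq, AlgHom.commutes]
    exact Algebra.commutes a y
  | add p q hp hq => rw [map_add]; exact hp.add_left hq
  | mul_X p i hp => rw [map_mul]; exact hp.mul_left (hf i)

lemma exists_exteriorHom {σ : Type} [Fintype σ] [DecidableEq σ] (e : σ → Λ)
    (he : ∀ i j, e i * e j = -(e j * e i)) :
    ∃ f : ExteriorAlgebra ℂ (σ → ℂ) →ₐ[ℂ] Λ,
      ∀ i, f (ExteriorAlgebra.ι ℂ (Pi.single i 1)) = e i := by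
  have hsq (v : σ → ℂ) : Fintype.linearCombination ℂ e v * Fintype.linearCombination ℂ e v = 0 := by
    apply eq_zero_of_eq_neg
    simp only [Fintype.linearCombination_apply, Finset.sum_mul_sum]
    conv_lhs => rw [Finset.sum_comm]
    simp only [← Finset.sum_neg_distrib]
    refine Finset.sum_congr rfl fun i _ => Finset.sum_congr rfl fun j _ => ?_
    rw [smul_mul_smul_comm, smul_mul_smul_comm, he j i, smul_neg, mul_comm]
  refine ⟨ExteriorAlgebra.lift ℂ ⟨Fintype.linearCombination ℂ e, hsq⟩, fun i => ?_⟩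
  simp

lemma commute_of_commute_ι {V : Type} [AddCommGroup V] [Module ℂ V]
    (f : ExteriorAlgebra ℂ V →ₐ[ℂ] Λ) (y : Λ)
    (hf : ∀ v, Commute y (f (ExteriorAlgebra.ι ℂ v))) (x : ExteriorAlgebra ℂ V) :
    Commute y (f x) := by
  induction x using ExteriorAlgebra.induction with
  | algebraMap a => rw [AlgHom.commutes]; exact (Algebra.commutes a y).symm
  | ι v => exact hf v
  | mul a b ha hb => rw [map_mul]; exact ha.mul_right hb
  | add a b ha hb => rw [map_add]; exact ha.add_right hb

namespace IsSuperPair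

variable {o : OddIndex → Λ} (h : IsSuperPair o)
include h

lemma evenMat_skew (i : Fin 3) (a b : Fin 7) : evenMat o i b a = -evenMat o i a b := by
  simp only [evenMat, Matrix.add_apply, Matrix.smul_apply, oddMat, Matrix.of_apply, h.skew _ a b,
    smul_eq_mul]
  simp
  abel

lemma commute_evenMat (i : Fin 3) (a b : Fin 7) (k : OddIndex) :
    Commute (evenMat o i a b) (o k) :=
  (h.commute_mul _ _ _).add_left (h.commute_mul _ _ _)

lemma exists_hom : ∃ Φ : SAlg →ₐ[ℂ] Λ,
    (∀ i, (Xgen i).map Φ = evenMat o i) ∧ ∀ α, (psiGen α).map Φ = oddMat o α := by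
  obtain ⟨f, hf⟩ := exists_aeval_of_commute
    (fun q : Fin 3 × UpperPos => evenMat o q.1 q.2.1.1 q.2.1.2) fun i j =>
      ((h.commute_evenMat _ _ _ _).mul_right (h.commute_evenMat _ _ _ _)).add_right
        ((h.commute_evenMat _ _ _ _).mul_right (h.commute_evenMat _ _ _ _))
  obtain ⟨e, he⟩ := exists_exteriorHom
    (fun q : Fin 2 × UpperPos => o (.inl (q.1, q.2.1.1, q.2.1.2))) fun _ _ => h.anticomm _ _
  have hι (v : Fin 2 × UpperPos → ℂ) : e (ExteriorAlgebra.ι ℂ v) =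
      ∑ q, v q • o (.inl (q.1, q.2.1.1, q.2.1.2)) := by
    conv_lhs => rw [← Finset.univ_sum_single v]
    rw [map_sum, map_sum]
    refine Finset.sum_congr rfl fun q _ => ?_
    rw [← he q, ← map_smul, ← map_smul, ← Pi.single_smul, smul_eq_mul, mul_one]
  have hc (p x) : Commute (f p) (e x) := by
    refine commute_of_commute_ι e _ (fun v => ?_) x
    rw [hι]
    refine Commute.sum_right _ _ _ fun q _ => Commute.smul_right ?_ _
    refine commute_of_commute_X f _ (fun r => ?_) p
    rw [hf]
    exact h.commute_evenMat _ _ _ _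
  refine ⟨Algebra.TensorProduct.lift f e hc, fun i => ?_, fun α => ?_⟩
  · ext a b
    simp only [Xgen, Matrix.map_apply, Matrix.of_apply]
    split_ifs with h1 h2
    · simp [hf]
    · simp [hf, h.evenMat_skew i a b]
    · obtain rfl : a = b := le_antisymm (not_lt.1 h2) (not_lt.1 h1)
      rw [map_zero, eq_comm]
      exact eq_zero_of_eq_neg (h.evenMat_skew i a a)
  · ext a b
    simp only [psiGen, eGen, Matrix.map_apply, Matrix.of_apply]
    split_ifs with h1 h2
    · simp [he, oddMat]
    · simp [he, oddMat, h.skew α b a]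
    · obtain rfl : a = b := le_antisymm (not_lt.1 h2) (not_lt.1 h1)
      rw [map_zero, eq_comm]
      exact eq_zero_of_eq_neg (h.skew α a a)

lemma map_XiNC_eq_zero (hX : XiNC (R := ℂ) Xgen psiGen ∈ Isc) :
    XiNC (R := ℂ) (evenMat o) (oddMat o) = 0 := by
  obtain ⟨Φ, hΦX, hΦψ⟩ := h.exists_hom
  have hmul (A B : Matrix (Fin 7) (Fin 7) SAlg) : (A * B).map Φ = A.map Φ * B.map Φ :=
    Matrix.map_mul
  have hadd (A B : Matrix (Fin 7) (Fin 7) SAlg) : (A + B).map Φ = A.map Φ + B.map Φ :=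
    Matrix.map_add Φ (map_add Φ) A B
  have hsub (A B : Matrix (Fin 7) (Fin 7) SAlg) : (A - B).map Φ = A.map Φ - B.map Φ :=
    Matrix.map_sub Φ (map_sub Φ) A B
  have hsmul (c : ℂ) (A : Matrix (Fin 7) (Fin 7) SAlg) : (c • A).map Φ = c • A.map Φ :=
    Matrix.map_smul Φ c (fun a => map_smul Φ c a) A
  have htr (A : Matrix (Fin 7) (Fin 7) SAlg) : Φ A.trace = (A.map Φ).trace :=
    AddMonoidHom.map_trace (Φ : SAlg →+ Λ) A
  have hker : Isc ≤ TwoSidedIdeal.ker Φ := by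
    refine TwoSidedIdeal.span_le.2 ?_
    rintro x ((⟨i, j, r, s, -, rfl⟩ | ⟨i, α, r, s, rfl⟩) | ⟨α, β, r, s, -, rfl⟩) <;>
      simp only [SetLike.mem_coe, TwoSidedIdeal.mem_ker]
    · rw [← Matrix.map_apply (f := Φ), hsub, hmul, hmul, hΦX, hΦX, h.even_mul_even,
        h.even_mul_even, h.pairing_symm]
      simp
    · rw [← Matrix.map_apply (f := Φ), hsub, hmul, hmul, hΦX, hΦψ]
      fin_cases α
      · simp [h.even_mul_odd_zero, h.odd_zero_mul_even]
      · simp [h.even_mul_odd_one, h.odd_one_mul_even]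
    · rw [← Matrix.map_apply (f := Φ), hadd, hmul, hmul, hΦψ, hΦψ, h.mat_rel]
      simp
  have h0 : Φ (XiNC (R := ℂ) Xgen psiGen) = 0 := (TwoSidedIdeal.mem_ker Φ).1 (hker hX)
  rw [← h0]
  simp only [XiNC, map_sum, map_zsmul, map_mul, map_sub, map_ofNat, htr, hmul, hadd, hsmul,
    hΦX, hΦψ]

end IsSuperPair
end Hom

section Contraction

abbrev OddSpace := OddIndex → ℂ

abbrev Grass := ExteriorAlgebra ℂ OddSpace

def contr (d : Module.Dual ℂ OddSpace) : Module.End ℂ Grass := CliffordAlgebra.contractLeft d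

lemma contr_anticomm (d d' : Module.Dual ℂ OddSpace) : contr d * contr d' = -(contr d' * contr d) :=
  LinearMap.ext fun x => CliffordAlgebra.contractLeft_comm (d := d) (d' := d') x

/-- The product of the vectors of a word, applied to `ω`. -/
def wordProd {A : Type} (v : A → OddSpace) (ω : Grass) : List A → Grass
  | [] => ω
  | l :: w => ExteriorAlgebra.ι ℂ (v l) * wordProd v ω w

lemma contr_ι_mul (d : Module.Dual ℂ OddSpace) (v : OddSpace) (x : Grass) :
    contr d (ExteriorAlgebra.ι ℂ v * x) = d v • x - ExteriorAlgebra.ι ℂ v * contr d x :=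
  CliffordAlgebra.contractLeft_ι_mul d v x

lemma contr_wordProd {A : Type} (v : A → OddSpace) (ω : Grass) (d : Module.Dual ℂ OddSpace)
    (hω : contr d ω = 0) (w : List A) :
    contr d (wordProd v ω w) =
      ((picks w).map fun t => t.1 • d (v t.2.1) • wordProd v ω t.2.2).sum := by
  induction w with
  | nil => simpa [wordProd, picks] using hω
  | cons l w ih =>
    rw [wordProd, contr_ι_mul, ih, picks, List.map_cons, List.sum_cons, one_smul, sub_eq_add_neg,
      ← List.sum_map_mul_left, List.sum_neg]
    simp [Function.comp_def, wordProd, -zsmul_eq_mul]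

def entryDual (α : Fin 2) (a b : Fin 7) : Module.Dual ℂ OddSpace :=
  (1 / 2 : ℂ) • (LinearMap.proj (.inl (α, a, b)) - LinearMap.proj (.inl (α, b, a)))

def letterVec (l : Letter) : OddSpace :=
  Pi.single (.inl l) 1 - Pi.single (.inl (l.1, l.2.2, l.2.1)) 1

lemma letterVec_flip (α : Fin 2) (a b : Fin 7) : letterVec (α, b, a) = -letterVec (α, a, b) := by
  simp [letterVec]

lemma entryDual_skew (α : Fin 2) (a b : Fin 7) : entryDual α b a = -entryDual α a b := by
  rw [entryDual, entryDual, ← smul_neg, neg_sub]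

lemma entryDual_letterVec (α : Fin 2) (a b : Fin 7) (l : Letter) :
    entryDual α a b (letterVec l) = if α = l.1 then
      (if a = l.2.1 ∧ b = l.2.2 then 1 else 0) - (if a = l.2.2 ∧ b = l.2.1 then 1 else 0)
      else 0 := by
  obtain ⟨β, x, y⟩ := l
  simp only [entryDual, letterVec, LinearMap.smul_apply, LinearMap.sub_apply,
    LinearMap.proj_apply, Pi.sub_apply, Pi.single_apply, Sum.inl.injEq, Prod.mk.injEq, smul_eq_mul]
  by_cases h1 : α = β
  · have e1 : (b = x ∧ a = y) = (a = y ∧ b = x) := propext and_comm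
    have e2 : (b = y ∧ a = x) = (a = x ∧ b = y) := propext and_comm
    simp only [h1, true_and, if_true, e1, e2]
    ring
  · simp [h1]

variable (ω : Grass)

/-- The value of a term for given labels and indices. -/
def termValue (α β : Fin 2) (a b : Fin 7) (t : Term) : Grass :=
  if t.1 = (α, β) ∧ t.2.1 = (a, b) then wordProd letterVec ω t.2.2 else 0

lemma sum_map_finsetSum {ι A M : Type} [AddCommMonoid M] (s : Finset ι) (f : ι → A → M)
    (L : List A) : ∑ k ∈ s, (L.map (f k)).sum = (L.map fun x => ∑ k ∈ s, f k x).sum := by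
  induction L with
  | nil => simp
  | cons x L ih => simp [Finset.sum_add_distrib, ih]

lemma sum_map_flatMap {A B M : Type} [AddCommMonoid M] (L : List A) (g : A → List B) (f : B → M) :
    ((L.flatMap g).map f).sum = (L.map fun x => ((g x).map f).sum).sum := by
  induction L with
  | nil => simp
  | cons x L ih => simp [ih]

lemma sum_ite_mul_ite (y z : Fin 7) (P Q : Prop) [Decidable P] [Decidable Q] :
    ∑ k, (if k = z ∧ P then (1 : ℂ) else 0) * (if Q ∧ k = y then 1 else 0) =
      if y = z ∧ Q ∧ P then 1 else 0 := by
  by_cases hP : P <;> by_cases hQ : Q <;> simp [hP, hQ, eq_comm]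

lemma sum_entryDual_mul (α β : Fin 2) (a b : Fin 7) (m l : Letter) :
    ∑ k, entryDual β k b (letterVec l) * entryDual α a k (letterVec m) =
      if α = m.1 ∧ β = l.1 then
        (if m.2.2 = l.2.1 ∧ a = m.2.1 ∧ b = l.2.2 then 1 else 0) -
        (if m.2.2 = l.2.2 ∧ a = m.2.1 ∧ b = l.2.1 then 1 else 0) -
        (if m.2.1 = l.2.1 ∧ a = m.2.2 ∧ b = l.2.2 then 1 else 0) +
        (if m.2.1 = l.2.2 ∧ a = m.2.2 ∧ b = l.2.1 then 1 else 0) else 0 := by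
  simp only [entryDual_letterVec]
  by_cases h1 : α = m.1
  · by_cases h2 : β = l.1
    · simp only [h1, h2, and_self, if_true, sub_mul, mul_sub, Finset.sum_sub_distrib,
        sum_ite_mul_ite]
      ring
    · simp [h2]
  · simp [h1]

lemma sum_map_ite_singleton (α β α' β' : Fin 2) (a b p q : Fin 7) (c : Prop) [Decidable c] (s : ℤ)
    (w : List Letter) :
    ((if c then [(s, ((α', β'), (p, q), w))] else []).map
      fun u : ℤ × Term => u.1 • termValue ω α β a b u.2).sum =
    ((s : ℂ) * if α = α' ∧ β = β' then (if c ∧ a = p ∧ b = q then 1 else 0) else 0) •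
      wordProd letterVec ω w := by
  by_cases hc : c
  · simp only [hc, if_true, termValue, List.map_cons, List.map_nil, List.sum_cons, List.sum_nil,
      add_zero, Prod.mk.injEq, true_and, ← ite_and, eq_comm (a := α'), eq_comm (a := β'),
      eq_comm (a := p), eq_comm (a := q), ← Int.cast_smul_eq_zsmul ℂ]
    split_ifs <;> simp
  · simp [hc]

lemma sum_glue (α β : Fin 2) (a b : Fin 7) (m l : Letter) (w : List Letter) :
    ∑ k, entryDual β k b (letterVec l) • entryDual α a k (letterVec m) • wordProd letterVec ω w =
      ((glue m l w).map fun u => u.1 • termValue ω α β a b u.2).sum := by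
  simp only [smul_smul, ← Finset.sum_smul, sum_entryDual_mul, glue, List.map_append,
    List.sum_append, sum_map_ite_singleton, ← add_smul]
  congr 1
  by_cases h : α = m.1 ∧ β = l.1
  · simp only [if_pos h]
    push_cast
    ring
  · simp only [if_neg h, mul_zero, add_zero]

def quadContr (α β : Fin 2) (a b : Fin 7) : Module.End ℂ Grass :=
  ∑ k, contr (entryDual α a k) * contr (entryDual β k b)

lemma quadContr_wordProd (hω : ∀ α a b, contr (entryDual α a b) ω = 0) (α β : Fin 2) (a b : Fin 7)
    (w : List Letter) : quadContr α β a b (wordProd letterVec ω w) =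
      ((quadTerms w).map fun t => t.1 • termValue ω α β a b t.2).sum := by
  simp only [quadContr, LinearMap.sum_apply, Module.End.mul_apply, contr_wordProd _ _ _ (hω _ _ _),
    map_list_sum, List.map_map, Function.comp_def, map_zsmul, map_smul, sum_map_finsetSum,
    quadTerms, sum_map_flatMap, List.smul_sum]
  refine congrArg List.sum (List.map_congr_left fun s _ => congrArg List.sum
    (List.map_congr_left fun t _ => ?_))
  have := congrArg (fun x => (s.1 * t.1) • x) (sum_glue ω α β a b t.2.1 s.2.1 t.2.2)
  simp only [List.smul_sum, List.map_map, Function.comp_def, Finset.smul_sum, ← mul_smul] at this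
  rw [← this]
  refine Finset.sum_congr rfl fun k _ => ?_
  simp only [← Int.cast_smul_eq_zsmul ℂ, smul_smul]
  congr 1
  push_cast
  ring

end Contraction

section Symmetrization

lemma picks_map {A B : Type} (f : A → B) (w : List A) :
    picks (w.map f) = (picks w).map fun t => (t.1, f t.2.1, t.2.2.map f) := by
  induction w with
  | nil => rfl
  | cons l w ih => simp [picks, ih]

lemma glue_relabel (k : Fin 2) (σ : Equiv.Perm (Fin 7)) (m l : Letter) (w : List Letter) :
    glue (relabel k σ m) (relabel k σ l) (w.map (relabel k σ)) =
      (glue m l w).map fun u => (u.1, relabelTerm k σ u.2) := by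
  simp only [glue, relabel, EmbeddingLike.apply_eq_iff_eq, List.map_append, apply_ite (List.map _),
    List.map_cons, List.map_nil, relabelTerm]

lemma quadTerms_relabel (k : Fin 2) (σ : Equiv.Perm (Fin 7)) (w : List Letter) :
    quadTerms (w.map (relabel k σ)) =
      (quadTerms w).map fun u => (u.1, relabelTerm k σ u.2) := by
  simp only [quadTerms, picks_map, List.flatMap_map, List.map_flatMap, glue_relabel, List.map_map]
  rfl

variable (ω : Grass) (α β : Fin 2) (a b : Fin 7)

/-- The symmetrized value of a term. -/
def symValue (t : Term) : Grass :=
  ∑ g : Fin 2 × Equiv.Perm (Fin 7),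
    (termValue ω α β a b (relabelTerm g.1 g.2 t) + termValue ω β α a b (relabelTerm g.1 g.2 t))

lemma symValue_relabel (k : Fin 2) (σ : Equiv.Perm (Fin 7)) (t : Term) :
    symValue ω α β a b (relabelTerm k σ t) = symValue ω α β a b t := by
  refine Fintype.sum_equiv ((Equiv.addLeft k).prodCongr (Equiv.mulRight σ)) _ _ fun g => ?_
  have : relabelTerm g.1 g.2 (relabelTerm k σ t) =
      relabelTerm (k + g.1) (g.2 * σ : Equiv.Perm (Fin 7)) t := by
    simp [relabelTerm, relabel, Function.comp_def, add_assoc]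
  rw [this]
  rfl

lemma symValue_swap (x y : Fin 2) (p : Fin 7 × Fin 7) (w : List Letter) :
    symValue ω α β a b ((x, y), p, w) = symValue ω α β a b ((y, x), p, w) := by
  refine Finset.sum_congr rfl fun g _ => ?_
  rw [add_comm]
  simp only [termValue, relabelTerm, Prod.mk.injEq, and_comm (a := x + g.1 = _)]

section Sorting

variable {A : Type} (v : Letter → OddSpace) (hv : ∀ α a b, v (α, b, a) = -v (α, a, b))

lemma wordProd_swap (l m : A) (u : A → OddSpace) (w : List A) :
    wordProd u ω (l :: m :: w) = -wordProd u ω (m :: l :: w) := by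
  rw [wordProd, wordProd, wordProd, wordProd, ← mul_assoc, ← mul_assoc, ← neg_mul]
  congr 1
  exact eq_neg_of_add_eq_zero_left (ExteriorAlgebra.ι_add_mul_swap (R := ℂ) (u l) (u m))

lemma wordProd_insertLetter (l : Letter) (w : List Letter) :
    wordProd v ω (l :: w) = (insertLetter l w).1 • wordProd v ω (insertLetter l w).2 := by
  induction w with
  | nil => simp [insertLetter]
  | cons m w ih =>
    rw [insertLetter]
    split_ifs
    · simp
    · rw [wordProd_swap, wordProd, ih, mul_smul_comm, neg_smul]
      rfl

include hv in
lemma wordProd_sortWord (w : List Letter) :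
    wordProd v ω w = (sortWord w).1 • wordProd v ω (sortWord w).2 := by
  induction w with
  | nil => simp [sortWord]
  | cons l w ih =>
    rw [sortWord]
    split_ifs
    · rw [mul_smul, ← wordProd_insertLetter, wordProd, ih, mul_smul_comm]
      rfl
    · rw [neg_smul, mul_smul, ← wordProd_insertLetter, wordProd, ih, mul_smul_comm, wordProd,
        hv l.1 l.2.1 l.2.2, map_neg, neg_mul, smul_neg, neg_neg]

end Sorting

lemma wordProd_map {A B : Type} (f : A → B) (v : B → OddSpace) (w : List A) :
    wordProd v ω (w.map f) = wordProd (v ∘ f) ω w := by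
  induction w with
  | nil => rfl
  | cons l w ih => simp [wordProd, ih]

lemma symValue_sortWord (x : Fin 2 × Fin 2) (p : Fin 7 × Fin 7) (w : List Letter) :
    symValue ω α β a b (x, p, w) =
      (sortWord w).1 • symValue ω α β a b (x, p, (sortWord w).2) := by
  simp only [symValue, Finset.smul_sum, smul_add, termValue, relabelTerm, wordProd_map]
  refine Finset.sum_congr rfl fun g _ => ?_
  rw [wordProd_sortWord ω (letterVec ∘ relabel g.1 g.2) (fun γ c d => letterVec_flip _ _ _) w]
  simp only [smul_ite, smul_zero]

end Symmetrization

section Certificates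

lemma letterCode_lt (l : Letter) : letterCode l < 98 := by
  obtain ⟨α, a, b⟩ := l
  simp only [letterCode]
  omega

lemma letterCode_injective : Function.Injective letterCode := by
  rintro ⟨α, a, b⟩ ⟨β, c, d⟩ h
  simp only [letterCode] at h
  simp only [Prod.mk.injEq, Fin.ext_iff]
  omega

lemma wordCode_injective : Function.Injective wordCode := by
  intro w
  induction w with
  | nil =>
    rintro (_ | ⟨m, w'⟩) h
    · rfl
    · simp only [wordCode] at h
      omega
  | cons l w ih =>
    rintro (_ | ⟨m, w'⟩) h
    · simp only [wordCode] at h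
      omega
    · simp only [wordCode] at h
      have h1 := letterCode_lt l
      have h2 := letterCode_lt m
      rw [letterCode_injective (a₁ := l) (a₂ := m) (by omega), ih (a₂ := w') (by omega)]

variable (ω : Grass) (α β : Fin 2) (a b : Fin 7)

lemma symValue_eq_of_termCode_eq {t u : Term} (h : termCode t = termCode u) :
    symValue ω α β a b t = symValue ω α β a b u := by
  obtain ⟨⟨x, y⟩, ⟨p, q⟩, w⟩ := t
  obtain ⟨⟨x', y'⟩, ⟨p', q'⟩, w'⟩ := u
  simp only [termCode] at h
  have hlabel : (x = x' ∧ y = y' ∨ x = y' ∧ y = x') := by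
    have : (if x ≤ y then x.val * 2 + y.val else y.val * 2 + x.val) =
        (if x' ≤ y' then x'.val * 2 + y'.val else y'.val * 2 + x'.val) := by
      split_ifs at h ⊢ <;> omega
    clear h
    revert x y x' y'
    decide
  have hw : wordCode w = wordCode w' ∧ p = p' ∧ q = q' := by
    simp only [Fin.ext_iff]
    split_ifs at h <;> omega
  obtain ⟨hw, rfl, rfl⟩ := hw
  obtain rfl := wordCode_injective hw
  rcases hlabel with ⟨rfl, rfl⟩ | ⟨rfl, rfl⟩
  · rfl
  · rw [symValue_swap]

open Classical in
/-- The symmetrized value of any term with a given code. -/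
def codeValue (n : ℕ) : Grass :=
  if h : ∃ t, termCode t = n then symValue ω α β a b h.choose else 0

lemma codeValue_termCode (t : Term) : codeValue ω α β a b (termCode t) = symValue ω α β a b t := by
  have h : ∃ u, termCode u = termCode t := ⟨t, rfl⟩
  rw [codeValue, dif_pos h]
  exact symValue_eq_of_termCode_eq _ _ _ _ _ h.choose_spec

lemma normalTerm_spec (s : ℤ) (t : Term) :
    (normalTerm s t).1 • codeValue ω α β a b (normalTerm s t).2 = s • symValue ω α β a b t := by
  rw [normalTerm, codeValue_termCode, mul_smul, ← symValue_sortWord]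

lemma indexMask_eq (f : Fin 7 → Fin 7) :
    indexMask f = ∑ j : Fin 7, (Finset.univ.filter fun i => f i = j).card * 8 ^ j.val := by
  have h : indexMask f = ∑ i, 8 ^ (f i).val := by
    simp only [indexMask, Fin.sum_univ_seven]
    rfl
  rw [h, ← Finset.sum_fiberwise (g := f)]
  refine Finset.sum_congr rfl fun j _ => ?_
  rw [Finset.sum_congr rfl (g := fun _ => 8 ^ j.val) (by simp +contextual)]
  simp

lemma eq_one_of_sum_eq (c : Fin 7 → ℕ) (hs : ∑ j, c j = 7) (hc : ∑ j, c j * 8 ^ j.val = 299593)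
    (j : Fin 7) : c j = 1 := by
  simp only [Fin.sum_univ_seven, Fin.isValue, Fin.coe_ofNat_eq_mod] at hs hc
  norm_num at hc
  have h0 : c 0 = 1 := by omega
  have h1 : c 1 = 1 := by omega
  have h2 : c 2 = 1 := by omega
  have h3 : c 3 = 1 := by omega
  fin_cases j <;> simp only [Fin.isValue, Fin.zero_eta, Fin.mk_one, Fin.reduceFinMk] <;> omega

lemma bijective_of_indexMask {f : Fin 7 → Fin 7} (hf : indexMask f = 299593) :
    Function.Bijective f := by
  have hs : ∑ j : Fin 7, (Finset.univ.filter fun i => f i = j).card = 7 := by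
    rw [← Finset.card_eq_sum_card_fiberwise (fun _ _ => Finset.mem_coe.2 (Finset.mem_univ _))]
    simp
  rw [indexMask_eq] at hf
  have h1 : ∀ j, (Finset.univ.filter fun i => f i = j).card = 1 :=
    eq_one_of_sum_eq _ hs hf
  refine Finite.surjective_iff_bijective.1 fun j => ?_
  obtain ⟨i, hi⟩ := Finset.card_pos.1 ((h1 j).symm ▸ Nat.one_pos)
  exact ⟨i, (Finset.mem_filter.1 hi).2⟩

lemma certify_spec (n : ℕ) (s : ℤ) (t : Term) :
    (certify n s t).1 • codeValue ω α β a b (certify n s t).2 = s • symValue ω α β a b t := by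
  rw [certify]
  split_ifs with h1 h2 h3
  · obtain ⟨σ, hσ⟩ : ∃ σ : Equiv.Perm (Fin 7), ⇑σ = digit n :=
      ⟨Equiv.ofBijective _ (bijective_of_indexMask h1), rfl⟩
    rw [← hσ] at h3
    have e := normalTerm_spec ω α β a b 1 t
    rw [h3.1, h3.2, neg_smul, normalTerm_spec, symValue_relabel, one_smul] at e
    rw [eq_zero_of_eq_neg e.symm, smul_zero, zero_smul]
  · exact normalTerm_spec ω α β a b s t
  · obtain ⟨σ, hσ⟩ : ∃ σ : Equiv.Perm (Fin 7), ⇑σ = digit n :=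
      ⟨Equiv.ofBijective _ (bijective_of_indexMask h1), rfl⟩
    rw [← hσ, normalTerm_spec, symValue_relabel]
  · exact normalTerm_spec ω α β a b s t

/-- The value of a formal sum of codes. -/
def codeSum (L : List (ℤ × ℕ)) : Grass := (L.map fun x => x.1 • codeValue ω α β a b x.2).sum

lemma codeSum_addTerm (s : ℤ) (n : ℕ) (L : List (ℤ × ℕ)) :
    codeSum ω α β a b (addTerm s n L) = s • codeValue ω α β a b n + codeSum ω α β a b L := by
  induction L with
  | nil => simp [codeSum, addTerm]
  | cons x L ih =>
    rw [addTerm]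
    cases h : Nat.beq n x.2
    · simp only [codeSum, cond_false, List.map_cons, List.sum_cons] at ih ⊢
      rw [ih]
      abel
    · obtain rfl := Nat.eq_of_beq_eq_true h
      simp only [codeSum, cond_true, List.map_cons, List.sum_cons, add_smul, add_assoc]

lemma codeSum_collected (ts : List (ℤ × Term)) (cs : List ℕ) (L : List (ℤ × ℕ)) :
    codeSum ω α β a b (collected ts cs L) =
      (ts.map fun t => t.1 • symValue ω α β a b t.2).sum + codeSum ω α β a b L := by
  induction ts generalizing cs L with
  | nil => simp [collected]
  | cons t ts ih =>
    rw [collected, ih, codeSum_addTerm, certify_spec, List.map_cons, List.sum_cons]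
    abel

lemma codeSum_eq_zero (L : List (ℤ × ℕ)) (hL : L.all (fun t => t.1 = 0) = true) :
    codeSum ω α β a b L = 0 := by
  simp only [List.all_eq_true, decide_eq_true_eq] at hL
  refine List.sum_eq_zero fun x hx => ?_
  obtain ⟨t, ht, rfl⟩ := List.mem_map.1 hx
  rw [hL t ht, zero_smul]

end Certificates

section Relations

/-- The terms of the quadratic contractions of a formal sum of words. -/
def allTerms (L : List (ℤ × List Letter)) : List (ℤ × Term) :=
  L.flatMap fun s => (quadTerms s.2).map fun t => (s.1 * t.1, t.2)

/-- The symmetrization of a formal sum of words, applied to `ω`. -/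
def symSum (ω : Grass) (L : List (ℤ × List Letter)) : Grass :=
  (L.map fun s => s.1 • ∑ g : Fin 2 × Equiv.Perm (Fin 7),
    wordProd letterVec ω (s.2.map (relabel g.1 g.2))).sum

def relContr (α β : Fin 2) (a b : Fin 7) : Module.End ℂ Grass :=
  quadContr α β a b + quadContr β α a b

lemma relContr_symSum (ω : Grass) (hω : ∀ α a b, contr (entryDual α a b) ω = 0) (α β : Fin 2)
    (a b : Fin 7) (L : List (ℤ × List Letter)) : relContr α β a b (symSum ω L) =
      ((allTerms L).map fun t => t.1 • symValue ω α β a b t.2).sum := by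
  simp only [symSum, map_list_sum, List.map_map, allTerms, sum_map_flatMap]
  refine congrArg List.sum (List.map_congr_left fun s _ => ?_)
  simp only [Function.comp_def, map_zsmul, map_sum, relContr, LinearMap.add_apply,
    quadContr_wordProd ω hω, quadTerms_relabel, List.map_map, ← List.sum_map_add, ← smul_add,
    sum_map_finsetSum, ← Finset.smul_sum, List.smul_sum, mul_smul]
  rfl

lemma relContr_symSum_eq_zero (ω : Grass) (hω : ∀ α a b, contr (entryDual α a b) ω = 0)
    (L : List (ℤ × List Letter)) (cs : List ℕ)
    (h : (collected (allTerms L) cs []).all (fun t => t.1 = 0) = true) (α β : Fin 2)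
    (a b : Fin 7) : relContr α β a b (symSum ω L) = 0 := by
  have hs := codeSum_collected ω α β a b (allTerms L) cs []
  rw [codeSum_eq_zero ω α β a b _ h, codeSum, List.map_nil, List.sum_nil, add_zero] at hs
  rw [relContr_symSum ω hω, ← hs]

/-- The elements killed by all the relations of a super-commuting pair. -/
def relSpace : Submodule ℂ Grass :=
  ⨅ (α : Fin 2) (β : Fin 2) (a : Fin 7) (b : Fin 7), LinearMap.ker (relContr α β a b)

lemma mem_relSpace {x : Grass} : x ∈ relSpace ↔ ∀ α β a b, relContr α β a b x = 0 := by
  simp [relSpace]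

lemma commute_quadContr (α β : Fin 2) (a b : Fin 7) (d : Module.Dual ℂ OddSpace) :
    Commute (quadContr α β a b) (contr d) := by
  refine Commute.sum_left _ _ _ fun k _ => ?_
  refine LinearMap.ext fun x => ?_
  have h (d' : Module.Dual ℂ OddSpace) (y : Grass) : contr d' (contr d y) = -contr d (contr d' y) :=
    LinearMap.congr_fun (contr_anticomm d' d) y
  simp only [Module.End.mul_apply, h, map_neg, neg_neg]

lemma contr_mem_relSpace (d : Module.Dual ℂ OddSpace) (x : Grass) (hx : x ∈ relSpace) :
    contr d x ∈ relSpace := by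
  rw [mem_relSpace] at hx ⊢
  intro α β a b
  have h : Commute (relContr α β a b) (contr d) :=
    (commute_quadContr _ _ _ _ _).add_left (commute_quadContr _ _ _ _ _)
  rw [← Module.End.mul_apply, h.eq, Module.End.mul_apply, hx, map_zero]

def oddDual : OddIndex → Module.Dual ℂ OddSpace
  | .inl (α, a, b) => entryDual α a b
  | .inr q => LinearMap.proj (.inr q)

section Restriction

variable {V : Type} [AddCommGroup V] [Module ℂ V] {j : V →ₗ[ℂ] Grass}
  {o : OddIndex → Module.End ℂ V}

lemma isSuperPair_of_contr (hj : Function.Injective j) (hV : ∀ x, j x ∈ relSpace)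
    (ho : ∀ i x, j (o i x) = contr (oddDual i) (j x)) : IsSuperPair o where
  anticomm i k := by
    refine LinearMap.ext fun x => hj ?_
    have h := LinearMap.congr_fun (contr_anticomm (oddDual i) (oddDual k)) (j x)
    simpa [ho] using h
  skew α a b := by
    refine LinearMap.ext fun x => hj ?_
    simp [ho, oddDual, entryDual_skew α a b, contr]
  rel α β a b := by
    refine LinearMap.ext fun x => hj ?_
    have h := mem_relSpace.1 (hV x) α β a b
    simpa [relContr, quadContr, ho, oddDual, Finset.sum_add_distrib] using h

end Restriction

end Relations

section TraceForm

def traceContr : Module.End ℂ Grass := ∑ a, quadContr 0 1 a a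

section Restriction

variable {V : Type} [AddCommGroup V] [Module ℂ V] {j : V →ₗ[ℂ] Grass}
  {o : OddIndex → Module.End ℂ V} (ho : ∀ i x, j (o i x) = contr (oddDual i) (j x))
include ho

lemma map_traceForm (x : V) : j (traceForm o x) = traceContr (j x) := by
  simp [traceForm, Matrix.trace, Matrix.mul_apply, oddMat, traceContr, quadContr, ho, oddDual]

lemma map_traceForm_pow (n : ℕ) (x : V) :
    j ((traceForm o ^ n) x) = (traceContr ^ n) (j x) := by
  induction n generalizing x with
  | zero => rfl
  | succ n ih =>
    rw [pow_succ, Module.End.mul_apply, ih, map_traceForm ho, pow_succ, Module.End.mul_apply]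

end Restriction

/-- A product of integers whose second factor is evaluated only when the first is nonzero. -/
def sparseMul (c x : ℤ) : ℤ := if c = 0 then 0 else c * x

lemma sparseMul_eq (c x : ℤ) : sparseMul c x = c * x := by
  unfold sparseMul
  split_ifs with h
  · rw [h, zero_mul]
  · rfl

def traceCoeff (m l : Letter) : ℤ :=
  if m.1 = 0 ∧ l.1 = 1 then
    2 * ((if m.2.2 = l.2.1 ∧ m.2.1 = l.2.2 then 1 else 0) -
      (if m.2.1 = l.2.1 ∧ m.2.2 = l.2.2 then 1 else 0))
  else 0

/-- The coefficient of `traceContr ^ n` on a word of length `2 * n`. -/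
def traceEval : ℕ → List Letter → ℤ
  | 0, _ => 1
  | n + 1, w => ((picks w).map fun s => ((picks s.2.2).map fun t =>
      sparseMul (traceCoeff t.2.1 s.2.1) (s.1 * t.1 * traceEval n t.2.2)).sum).sum

lemma length_of_mem_picks {A : Type} {w : List A} {t : ℤ × A × List A} (h : t ∈ picks w) :
    w.length = t.2.2.length + 1 := by
  induction w generalizing t with
  | nil => simp [picks] at h
  | cons l w ih =>
    simp only [picks, List.mem_cons, List.mem_map] at h
    rcases h with rfl | ⟨u, hu, rfl⟩
    · rfl
    · simp [ih hu]

lemma sum_termValue_diagonal (ω : Grass) (t : Term) :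
    ∑ a, termValue ω 0 1 a a t =
      if t.1 = (0, 1) ∧ t.2.1.1 = t.2.1.2 then wordProd letterVec ω t.2.2 else 0 := by
  obtain ⟨c, ⟨p, q⟩, v⟩ := t
  by_cases hc : c = (0, 1) <;> by_cases hp : p = q <;> simp [termValue, hc, hp]
  refine Finset.sum_eq_zero fun a _ => if_neg ?_
  rintro ⟨rfl, rfl⟩
  exact hp rfl

lemma sum_glue_diagonal (ω : Grass) (m l : Letter) (w : List Letter) :
    ((glue m l w).map fun u => u.1 • ∑ a, termValue ω 0 1 a a u.2).sum =
      traceCoeff m l • wordProd letterVec ω w := by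
  have h (c : Prop) [Decidable c] (s : ℤ) (p q : Fin 7) :
      ((if c then [(s, ((m.1, l.1), (p, q), w))] else []).map
        fun u : ℤ × Term => u.1 • ∑ a, termValue ω 0 1 a a u.2).sum =
      (s * if m.1 = 0 ∧ l.1 = 1 then (if c ∧ p = q then 1 else 0) else 0) •
        wordProd letterVec ω w := by
    by_cases hc : c
    · by_cases hm : m.1 = 0 ∧ l.1 = 1 <;> by_cases hp : p = q <;>
        simp [hc, hm, hp, sum_termValue_diagonal]
    · simp [hc]
  simp only [glue, List.map_append, List.sum_append, h, ← add_smul, traceCoeff]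
  congr 1
  obtain ⟨α, p, q⟩ := m
  obtain ⟨β, p', q'⟩ := l
  dsimp only
  by_cases hm : α = 0 ∧ β = 1
  · simp only [hm, if_true, and_self, and_comm (a := q = q') (b := p = p'),
      and_comm (a := q = p') (b := p = q')]
    ring
  · simp only [hm, if_false, mul_zero, add_zero]

lemma traceContr_wordProd (ω : Grass) (hω : ∀ α a b, contr (entryDual α a b) ω = 0)
    (w : List Letter) : traceContr (wordProd letterVec ω w) =
      ((picks w).map fun s => ((picks s.2.2).map fun t =>
        (s.1 * t.1 * traceCoeff t.2.1 s.2.1) • wordProd letterVec ω t.2.2).sum).sum := by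
  simp only [traceContr, LinearMap.sum_apply, quadContr_wordProd ω hω, sum_map_finsetSum,
    quadTerms, sum_map_flatMap, List.map_map, Function.comp_def, ← Finset.smul_sum, mul_smul,
    ← sum_glue_diagonal, List.smul_sum]

lemma traceContr_pow_wordProd (ω : Grass) (hω : ∀ α a b, contr (entryDual α a b) ω = 0) (n : ℕ)
    (w : List Letter) (hw : w.length = 2 * n) :
    (traceContr ^ n) (wordProd letterVec ω w) = traceEval n w • ω := by
  induction n generalizing w with
  | zero =>
    obtain rfl := List.length_eq_zero_iff.1 hw
    simp [wordProd, traceEval]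
  | succ n ih =>
    rw [pow_succ, Module.End.mul_apply, traceContr_wordProd ω hω]
    simp only [map_list_sum, List.map_map, traceEval, List.sum_smul]
    refine congrArg List.sum (List.map_congr_left fun s hs => ?_)
    simp only [Function.comp_def, map_list_sum, List.map_map, List.sum_smul]
    refine congrArg List.sum (List.map_congr_left fun t ht => ?_)
    have h1 := length_of_mem_picks hs
    have h2 := length_of_mem_picks ht
    simp only [map_zsmul, ih t.2.2 (by omega), sparseMul_eq, smul_smul]
    congr 1
    ring

lemma traceEval_relabel (σ : Equiv.Perm (Fin 7)) (n : ℕ) (w : List Letter) :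
    traceEval n (w.map (relabel 0 σ)) = traceEval n w := by
  induction n generalizing w with
  | zero => rfl
  | succ n ih =>
    simp [traceEval, picks_map, Function.comp_def, ih, traceCoeff, relabel]

/-- The coefficient of `traceContr ^ 4` on a symmetrized sum of words. -/
def traceTotal (L : List (ℤ × List Letter)) : ℤ :=
  (L.map fun s => s.1 * (5040 * (traceEval 4 (s.2.map (relabel 0 id)) +
    traceEval 4 (s.2.map (relabel 1 id))))).sum

lemma traceContr_pow_symSum (ω : Grass) (hω : ∀ α a b, contr (entryDual α a b) ω = 0)
    (L : List (ℤ × List Letter)) (hL : L.all (fun s => s.2.length = 8) = true) :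
    (traceContr ^ 4) (symSum ω L) = traceTotal L • ω := by
  simp only [List.all_eq_true, decide_eq_true_eq] at hL
  simp only [symSum, traceTotal, map_list_sum, List.map_map, List.sum_smul]
  refine congrArg List.sum (List.map_congr_left fun s hs => ?_)
  simp only [Function.comp_def, map_zsmul, map_sum, mul_smul]
  congr 1
  have hg (g : Fin 2 × Equiv.Perm (Fin 7)) :
      (traceContr ^ 4) (wordProd letterVec ω (s.2.map (relabel g.1 g.2))) =
        traceEval 4 (s.2.map (relabel g.1 id)) • ω := by
    rw [traceContr_pow_wordProd ω hω 4 _ (by simpa using hL s hs),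
      ← traceEval_relabel g.2 4 (s.2.map (relabel g.1 id)), List.map_map]
    congr 3
    funext l
    simp [relabel]
  simp only [hg, Fintype.sum_prod_type, Fin.sum_univ_two, Finset.sum_const, Finset.card_univ,
    Fintype.card_perm, Fintype.card_fin, ← smul_add, ← add_smul]
  rw [← natCast_zsmul]
  rfl

end TraceForm

section Pairing

/-- The vectors dual to the last six coordinates. -/
def auxVec (q : Fin 3 × Fin 2) : OddSpace := Pi.single (.inr q) 1

abbrev auxDual (q : Fin 3 × Fin 2) : Module.Dual ℂ OddSpace := oddDual (.inr q)

lemma auxDual_auxVec (q r : Fin 3 × Fin 2) : auxDual q (auxVec r) = if r = q then 1 else 0 := by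
  simp [auxDual, oddDual, auxVec, Pi.single_apply, eq_comm]

lemma contr_one (d : Module.Dual ℂ OddSpace) : contr d 1 = 0 :=
  CliffordAlgebra.contractLeft_one (Q := 0) d

lemma contr_entryDual_wordProd_auxVec (α : Fin 2) (a b : Fin 7) (w : List (Fin 3 × Fin 2)) :
    contr (entryDual α a b) (wordProd auxVec 1 w) = 0 := by
  rw [contr_wordProd _ _ _ (contr_one _)]
  refine List.sum_eq_zero fun x hx => ?_
  obtain ⟨t, -, rfl⟩ := List.mem_map.1 hx
  simp [entryDual, auxVec]

def pairContr (i l : Fin 3) : Module.End ℂ Grass :=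
  contr (auxDual (i, 0)) * contr (auxDual (l, 1)) - contr (auxDual (i, 1)) * contr (auxDual (l, 0))

def pairCoeff (p : Fin 3 × Fin 3) (q r : Fin 3 × Fin 2) : ℤ :=
  (if q = (p.2, 1) ∧ r = (p.1, 0) then 1 else 0) - (if q = (p.2, 0) ∧ r = (p.1, 1) then 1 else 0)

/-- The coefficient of a product of operators `pairContr` on a word. -/
def pairEval : List (Fin 3 × Fin 3) → List (Fin 3 × Fin 2) → ℤ
  | [], _ => 1
  | p :: ps, w => ((picks w).map fun t => ((picks t.2.2).map fun u =>
      sparseMul (pairCoeff p t.2.1 u.2.1) (t.1 * u.1 * pairEval ps u.2.2)).sum).sum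

lemma sum_map_sub {A M : Type} [AddCommGroup M] (L : List A) (f g : A → M) :
    (L.map fun x => f x - g x).sum = (L.map f).sum - (L.map g).sum := by
  induction L with
  | nil => simp
  | cons x L ih =>
    simp only [List.map_cons, List.sum_cons, ih]
    abel

lemma pairContr_wordProd (p : Fin 3 × Fin 3) (w : List (Fin 3 × Fin 2)) :
    pairContr p.1 p.2 (wordProd auxVec 1 w) = ((picks w).map fun t => ((picks t.2.2).map fun u =>
      (t.1 * u.1 * pairCoeff p t.2.1 u.2.1) • wordProd auxVec 1 u.2.2).sum).sum := by
  simp only [pairContr, LinearMap.sub_apply, Module.End.mul_apply,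
    contr_wordProd _ _ _ (contr_one _), map_list_sum, List.map_map, ← sum_map_sub]
  refine congrArg List.sum (List.map_congr_left fun t _ => ?_)
  simp only [Function.comp_def, map_zsmul, map_smul, contr_wordProd _ _ _ (contr_one _),
    List.smul_sum, List.map_map, ← sum_map_sub, auxDual_auxVec]
  refine congrArg List.sum (List.map_congr_left fun u _ => ?_)
  simp only [← Int.cast_smul_eq_zsmul ℂ, smul_smul, ← sub_smul, pairCoeff]
  congr 1
  push_cast
  simp only [ite_and]
  split_ifs <;> simp

def pairContrs : List (Fin 3 × Fin 3) → Module.End ℂ Grass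
  | [] => 1
  | p :: ps => pairContrs ps * pairContr p.1 p.2

lemma pairContrs_wordProd (ps : List (Fin 3 × Fin 3)) (w : List (Fin 3 × Fin 2))
    (hw : w.length = 2 * ps.length) :
    pairContrs ps (wordProd auxVec 1 w) = pairEval ps w • (1 : Grass) := by
  induction ps generalizing w with
  | nil =>
    obtain rfl := List.length_eq_zero_iff.1 hw
    simp [wordProd, pairEval, pairContrs]
  | cons p ps ih =>
    simp only [pairContrs, Module.End.mul_apply, pairContr_wordProd, map_list_sum, List.map_map,
      pairEval, List.sum_smul]
    refine congrArg List.sum (List.map_congr_left fun t ht => ?_)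
    simp only [Function.comp_def, map_list_sum, List.map_map, List.sum_smul]
    refine congrArg List.sum (List.map_congr_left fun u hu => ?_)
    have h1 := length_of_mem_picks ht
    have h2 := length_of_mem_picks hu
    rw [List.length_cons] at hw
    simp only [map_zsmul, ih u.2.2 (by omega), sparseMul_eq, smul_smul]
    congr 1
    ring

/-- The word of all six auxiliary variables. -/
def auxWord : List (Fin 3 × Fin 2) := [(0, 0), (0, 1), (1, 0), (1, 1), (2, 0), (2, 1)]

def pairTotal : ℤ := ∑ i : Fin 3, ∑ j : Fin 3, ∑ k : Fin 3, ∑ l : Fin 3, ∑ m : Fin 3, ∑ n : Fin 3,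
  sparseMul (eps i j k * eps l m n) (pairEval [(k, n), (j, m), (i, l)] auxWord)

section Restriction

variable {V : Type} [AddCommGroup V] [Module ℂ V] {j : V →ₗ[ℂ] Grass}
  {o : OddIndex → Module.End ℂ V} (ho : ∀ i x, j (o i x) = contr (oddDual i) (j x))
include ho

lemma map_pairing (i l : Fin 3) (x : V) : j (pairing o i l x) = pairContr i l (j x) := by
  simp [pairing, pairContr, ho]

lemma map_pairingSum (x : V) (c : ℤ) (hx : j x = c • wordProd auxVec 1 auxWord) :
    j (pairingSum o x) = (c * pairTotal) • (1 : Grass) := by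
  have h (i' j' k' l m n : Fin 3) : j ((pairing o i' l * pairing o j' m * pairing o k' n) x) =
      c • pairEval [(k', n), (j', m), (i', l)] auxWord • (1 : Grass) := by
    rw [← pairContrs_wordProd _ _ rfl, ← map_zsmul, ← hx]
    simp [map_pairing ho, pairContrs]
  simp only [pairingSum, LinearMap.sum_apply, LinearMap.smul_apply, map_sum, map_zsmul, h,
    sparseMul_eq, mul_smul, pairTotal, Finset.sum_smul, Finset.smul_sum]
  simp only [smul_comm c]

end Restriction

end Pairing

section Evaluation

lemma pairTotal_ne_zero : pairTotal ≠ 0 := by decide +kernel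

lemma IsSuperPair.pairingSum_mul_traceForm_apply {V : Type} [AddCommGroup V] [Module ℂ V]
    {o : OddIndex → Module.End ℂ V} (h : IsSuperPair o) (hX : XiNC (R := ℂ) Xgen psiGen ∈ Isc)
    (x : V) : pairingSum o ((traceForm o ^ 4) x) = 0 := by
  have h0 := h.map_XiNC_eq_zero hX
  rw [h.XiNC_eq, ← Int.cast_smul_eq_zsmul ℂ] at h0
  rw [← Module.End.mul_apply, (smul_eq_zero.1 h0).resolve_left (by norm_num),
    LinearMap.zero_apply]

lemma not_mem_Isc_of_contr {V : Type} [AddCommGroup V] [Module ℂ V] {j : V →ₗ[ℂ] Grass}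
    {o : OddIndex → Module.End ℂ V} (hj : Function.Injective j) (hV : ∀ x, j x ∈ relSpace)
    (ho : ∀ i x, j (o i x) = contr (oddDual i) (j x)) (L : List (ℤ × List Letter))
    (hL : L.all (fun s => s.2.length = 8) = true) (htot : traceTotal L ≠ 0) (x : V)
    (hx : j x = symSum (wordProd auxVec 1 auxWord) L) : XiNC (R := ℂ) Xgen psiGen ∉ Isc := by
  intro hX
  have h := congrArg j ((isSuperPair_of_contr hj hV ho).pairingSum_mul_traceForm_apply hX x)
  have hω (α a b) := contr_entryDual_wordProd_auxVec α a b auxWord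
  rw [map_zero, map_pairingSum ho _ (traceTotal L)
    (by rw [map_traceForm_pow ho, hx, traceContr_pow_symSum _ hω L hL]),
    ← Int.cast_smul_eq_zsmul ℂ] at h
  simp [htot, pairTotal_ne_zero] at h

lemma not_mem_Isc_of_certificates (L : List (ℤ × List Letter)) (cs : List ℕ)
    (hL : L.all (fun s => s.2.length = 8) = true)
    (hrel : (collected (allTerms L) cs []).all (fun t => t.1 = 0) = true)
    (htot : traceTotal L ≠ 0) : XiNC (R := ℂ) Xgen psiGen ∉ Isc :=
  not_mem_Isc_of_contr (j := relSpace.subtype)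
    (o := fun i => (contr (oddDual i)).restrict (contr_mem_relSpace _)) relSpace.injective_subtype
    (fun x => x.2) (fun _ _ => rfl) L hL htot
    ⟨_, mem_relSpace.2 (relContr_symSum_eq_zero _
      (fun α a b => contr_entryDual_wordProd_auxVec α a b auxWord) L cs hrel)⟩ rfl

end Evaluation

section Seed

def seed : List (ℤ × List Letter) :=
  [(-6, [(0, 0, 1), (0, 0, 2), (0, 1, 3), (0, 2, 3), (1, 0, 1), (1, 0, 2), (1, 1, 3), (1, 2, 3)]),
   (24, [(0, 0, 1), (0, 0, 2), (0, 1, 3), (0, 2, 3), (1, 0, 1), (1, 0, 2), (1, 1, 4), (1, 2, 4)]),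
   (-24, [(0, 0, 1), (0, 0, 2), (0, 1, 3), (0, 2, 3), (1, 0, 1), (1, 0, 4), (1, 1, 5), (1, 4, 5)]),
   (-12, [(0, 0, 1), (0, 0, 2), (0, 1, 3), (0, 2, 3), (1, 0, 4), (1, 0, 5), (1, 3, 4), (1, 3, 5)]),
   (24, [(0, 0, 1), (0, 0, 2), (0, 1, 3), (0, 2, 3), (1, 0, 4), (1, 0, 5), (1, 4, 6), (1, 5, 6)]),
   (-24, [(0, 0, 1), (0, 0, 2), (0, 0, 4), (0, 3, 4), (1, 0, 1), (1, 0, 2), (1, 0, 4), (1, 3, 4)]),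
   (24, [(0, 0, 1), (0, 0, 2), (0, 0, 4), (0, 3, 4), (1, 0, 1), (1, 0, 2), (1, 0, 5), (1, 3, 5)]),
   (-96, [(0, 0, 1), (0, 0, 2), (0, 0, 4), (0, 3, 4), (1, 0, 1), (1, 2, 5), (1, 3, 4), (1, 4, 5)]),
   (-96, [(0, 0, 1), (0, 0, 2), (0, 0, 4), (0, 3, 4), (1, 0, 1), (1, 2, 5), (1, 3, 6), (1, 5, 6)]),
   (24, [(0, 0, 1), (0, 0, 2), (0, 0, 4), (0, 3, 4), (1, 0, 4), (1, 1, 3), (1, 2, 3), (1, 3, 4)]),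
   (96, [(0, 0, 1), (0, 0, 2), (0, 0, 4), (0, 3, 4), (1, 0, 4), (1, 1, 3), (1, 2, 5), (1, 4, 5)]),
   (-24, [(0, 0, 1), (0, 0, 2), (0, 0, 4), (0, 3, 4), (1, 0, 5), (1, 1, 3), (1, 2, 3), (1, 3, 5)]),
   (-96, [(0, 0, 1), (0, 0, 2), (0, 0, 4), (0, 3, 4), (1, 0, 5), (1, 1, 3), (1, 2, 6), (1, 5, 6)]),
   (-48, [(0, 0, 1), (0, 2, 4), (0, 3, 5), (0, 4, 5), (1, 0, 1), (1, 2, 4), (1, 3, 5), (1, 4, 5)]),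
   (48, [(0, 0, 1), (0, 2, 4), (0, 3, 5), (0, 4, 5), (1, 0, 1), (1, 2, 4), (1, 3, 6), (1, 4, 6)]),
   (-48, [(0, 0, 1), (0, 2, 4), (0, 3, 5), (0, 4, 5), (1, 0, 2), (1, 1, 4), (1, 3, 6), (1, 4, 6)]),
   (-48, [(0, 0, 1), (0, 2, 4), (0, 3, 5), (0, 4, 5), (1, 0, 2), (1, 1, 6), (1, 3, 5), (1, 5, 6)]),
   (24, [(0, 0, 1), (0, 2, 4), (0, 3, 5), (0, 4, 5), (1, 0, 4), (1, 1, 5), (1, 2, 3), (1, 4, 5)]),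
   (-2, [(0, 0, 4), (0, 1, 4), (0, 2, 4), (0, 3, 4), (1, 0, 4), (1, 1, 4), (1, 2, 4), (1, 3, 4)]),
   (24, [(0, 0, 4), (0, 1, 4), (0, 2, 4), (0, 3, 4), (1, 0, 4), (1, 1, 4), (1, 2, 5), (1, 3, 5)]),
   (-6, [(0, 0, 4), (0, 1, 4), (0, 2, 4), (0, 3, 4), (1, 0, 5), (1, 1, 5), (1, 2, 5), (1, 3, 5)]),
   (24, [(0, 0, 4), (0, 1, 4), (0, 2, 4), (0, 3, 4), (1, 0, 5), (1, 1, 5), (1, 2, 6), (1, 3, 6)]),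
   (6, [(0, 0, 4), (0, 1, 4), (0, 2, 5), (0, 3, 5), (1, 0, 4), (1, 1, 4), (1, 2, 5), (1, 3, 5)]),
   (-24, [(0, 0, 4), (0, 1, 4), (0, 2, 5), (0, 3, 5), (1, 0, 4), (1, 1, 4), (1, 2, 6), (1, 3, 6)]),
   (-48, [(0, 0, 4), (0, 1, 4), (0, 2, 5), (0, 3, 5), (1, 0, 4), (1, 1, 6), (1, 2, 4), (1, 3, 6)]),
   (-6, [(0, 0, 4), (0, 1, 4), (0, 2, 5), (0, 3, 5), (1, 0, 5), (1, 1, 5), (1, 2, 4), (1, 3, 4)]),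
   (-4, [(0, 0, 1), (0, 0, 2), (0, 0, 3), (0, 4, 5), (1, 0, 1), (1, 0, 2), (1, 0, 3), (1, 4, 5)]),
   (24, [(0, 0, 1), (0, 0, 2), (0, 0, 3), (0, 4, 5), (1, 0, 1), (1, 2, 6), (1, 3, 6), (1, 4, 5)]),
   (-12, [(0, 0, 1), (0, 2, 3), (0, 4, 6), (0, 5, 6), (1, 0, 1), (1, 2, 3), (1, 4, 6), (1, 5, 6)]),
   (24, [(0, 0, 1), (0, 2, 3), (0, 4, 6), (0, 5, 6), (1, 0, 1), (1, 2, 4), (1, 3, 6), (1, 5, 6)])]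

def certificates : List ℕ :=
  [800229, 799653, 800667, 800667, 800229, 799653, 800271, 799695, 800271, 800667, 800667, 799695,
   799995, 800571, 799995, 800667, 800667, 800571, 800037, 800613, 800037, 800613, 800667, 800667,
   800667, 800667, 1623772, 1623196, 1623772, 1623196, 1623814, 800667, 800667, 1623238, 1623814,
   1623238, 1623538, 800667, 800667, 1624114, 1623538, 1624114, 1623580, 1624156, 800667, 800667,
   1623580, 1624156, 800229, 799653, 800667, 800667, 800229, 1614964, 800271, 799695, 800271,
   800667, 800667, 1615006, 799995, 798513, 799995, 1613944, 800037, 798555, 800037, 1614028,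
   800667, 800667, 1619656, 799653, 1619656, 1614964, 1619698, 800667, 800667, 799695, 1619698,
   1615006, 1617364, 792459, 1617364, 1624114, 1617406, 792543, 1617406, 1624156, 785823, 799653,
   800667, 800667, 1564678, 1536172, 785865, 780585, 785865, 1564840, 799995, 767643, 799995,
   1534858, 780927, 767685, 800667, 800667, 785823, 799653, 1564678, 1536172, 1567072, 793041,
   1567072, 1542976, 1552978, 734835, 1552978, 1614706, 1559782, 1617100, 781023, 780459, 1580800,
   1537582, 781065, 780585, 1580632, 1537414, 780801, 782049, 1581484, 1538266, 780927, 782091,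
   1581316, 1538098, 793167, 793041, 1532746, 1575274, 735543, 735417, 1547152, 1618492, 793851,
   793725, 1575616, 1533772, 736227, 736101, 1618834, 1548178, 2337311, 662817, 1111282, 1068064,
   2337311, 662985, 1111072, 1067854, 663159, 664743, 663327, 664785, 692325, 692199, 2447453,
   873496, 620295, 620169, 2447453, 931120, 991144, 1533772, 1048768, 1548178, 796113, 790821,
   800667, 800667, 798513, 791163, 796155, 790695, 798555, 800667, 800667, 791037, 793215, 793047,
   799695, 793557, 793389, 800667, 800667, 794949, 800037, 800037, 800667, 800667, 800667, 800667,
   1622056, 1614706, 1619656, 1614364, 1622098, 800667, 800667, 1614580, 1619698, 1614238,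
   1617100, 1616932, 800667, 800667, 1618492, 1616758, 1616590, 1623238, 1623580, 800667, 800667,
   1623580, 796113, 790821, 800667, 800667, 798513, 1542334, 796155, 790695, 798555, 800667,
   800667, 1542208, 793215, 793047, 785289, 793557, 793389, 1532800, 785631, 1533772, 800667,
   800667, 1593244, 790821, 1576438, 1542334, 1593286, 800667, 800667, 790695, 1576480, 1542208,
   1559476, 1559308, 723663, 1559134, 1558966, 1623238, 724635, 1623580, 796113, 790821, 800667,
   800667, 796155, 790695, 798555, 1535878, 793215, 793047, 799695, 793557, 794949, 1542934,
   800037, 800667, 800667, 1537120, 800667, 800667, 1571638, 1564288, 729141, 1614238, 800037,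
   800667, 800667, 1541914, 736239, 1551232, 1616590, 1558378, 796113, 689979, 800667, 800667,
   796155, 790695, 798555, 1072534, 692373, 793047, 569199, 692715, 569541, 861802, 800667,
   800667, 1225894, 689979, 611541, 937156, 203961, 1541914, 1054756, 1558378, 795771, 790821,
   791163, 1618450, 795813, 790695, 791037, 1618492, 793215, 793047, 799695, 800667, 800667,
   1623238, 800037, 800037, 793851, 793725, 800667, 800667, 1616710, 1616584, 800667, 800667,
   1623238, 1623238, 795249, 1614364, 1619656, 1614706, 795291, 1614238, 1619698, 1614580, 800037,
   800667, 800667, 1623580, 1617100, 1616932, 795771, 790821, 791163, 778107, 795813, 790695,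
   791037, 1535878, 793215, 793047, 799695, 800667, 800667, 1538482, 800037, 800037, 777387,
   1541908, 1583146, 1566514, 800667, 800667, 1592074, 1542934, 778449, 1564972, 729141, 1614580,
   734139, 1558414, 1559740, 1616932, 795771, 790773, 1539886, 1572838, 795813, 790689, 1539802,
   1572922, 793167, 793041, 785289, 1532746, 785631, 777387, 777261, 1533142, 1556686, 1556560,
   723663, 1623238, 778449, 774993, 1576438, 1542970, 778533, 774909, 1576480, 1542886, 724635,
   1623580, 1559770, 1559644, 694929, 2346815, 1072084, 660465, 694971, 689847, 2437481, 870850,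
   2346815, 692199, 670041, 1062802, 670383, 660081, 1206190, 2437481, 723663, 937882, 660807,
   657687, 208173, 1542886, 1055530, 1559644, 800667, 800667, 718665, 800667, 800667, 713871,
   790401, 800667, 800667, 756795, 735423, 792459, 728571, 742095, 800667, 800667, 800667, 800667,
   800667, 800667, 1537414, 1542208, 800667, 800667, 1580338, 1613944, 1552114, 1565638, 800667,
   800667, 1558966, 1616002, 800667, 800667, 718665, 800667, 800667, 932362, 689559, 847396,
   735423, 691617, 728571, 855718, 800667, 800667, 800667, 800667, 713871, 937156, 124695,
   1613944, 1047904, 133017, 1054756, 1616002, 644853, 623421, 603417, 642747, 769743, 937156,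
   689553, 847432, 620175, 691611, 735933, 2443043, 1266754, 1144564, 1264438, 1290718, 718791,
   922876, 124689, 1613980, 1055098, 2443043, 1040518, 1616038, 644853, 870724, 603417, 642747,
   790401, 800667, 800667, 888976, 620175, 792459, 742095, 928666, 1122694, 623547, 1005130,
   1542334, 800667, 800667, 756795, 922540, 989482, 220329, 1559134, 1039846, 741039, 711957,
   718659, 769755, 742185, 713865, 790401, 797673, 729243, 756795, 735417, 792459, 733593, 777387,
   800667, 800667, 1566976, 1592578, 1538272, 1542682, 1552306, 1620784, 1581778, 1615000,
   1563670, 1536028, 1556560, 1599202, 800667, 800667, 1559488, 1617394, 796251, 796125, 794949,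
   800667, 800667, 796251, 796125, 794949, 796257, 796113, 794937, 796257, 800667, 800667, 796113,
   794937, 796173, 796155, 794811, 796173, 796155, 800667, 800667, 794811, 795291, 795273, 795105,
   795291, 795273, 795105, 800667, 800667, 800667, 800667, 1619794, 1619668, 1618492, 1619794,
   1619668, 1618492, 1619800, 800667, 800667, 1619656, 1618480, 1619800, 1619656, 1618480,
   1619716, 1619698, 800667, 800667, 1618354, 1619716, 1619698, 1618354, 1618834, 1618816,
   1618648, 800667, 800667, 1618834, 1618816, 1618648, 796251, 796125, 794949, 800667, 800667,
   796251, 796257, 796113, 794937, 796257, 800667, 800667, 796173, 796155, 794811, 796173, 796155,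
   1532800, 795291, 795273, 795105, 795291, 795273, 1533682, 800667, 800667, 1586572, 1573720,
   1572838, 1576576, 1586578, 800667, 800667, 1573696, 1572814, 1576582, 724341, 1618354, 724635,
   1618648, 796251, 796125, 794949, 1533376, 796257, 796113, 794937, 1533394, 796173, 796155,
   794811, 1533478, 795291, 795273, 795105, 1533772, 724239, 1576576, 1576450, 1575274, 724257,
   1576582, 1576438, 1575262, 724341, 1576498, 1576480, 1575136, 724635, 1575616, 1575598,
   1575430, 796251, 694947, 694065, 1180822, 796257, 694929, 694047, 1180846, 796173, 796155,
   693969, 877384, 795291, 795273, 694263, 878560, 606591, 1173208, 606615, 1173214, 202695,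
   1575136, 203871, 1575430, 753033, 800667, 800667, 763029, 753039, 763035, 800667, 800667,
   794811, 800667, 800667, 746799, 795105, 747093, 800667, 800667, 800667, 800667, 1586572,
   1576576, 1586578, 800667, 800667, 1576582, 800667, 800667, 1570342, 1618354, 1570636, 800667,
   800667, 1618648, 753033, 800667, 800667, 763029, 753039, 763035, 800667, 800667, 693969,
   848572, 694263, 849748, 800667, 800667, 1284046, 1173208, 1284052, 800667, 800667, 1173214,
   125871, 1618354, 127047, 1618648, 637491, 800667, 800667, 750177, 753039, 763035, 910906,
   752553, 693969, 606741, 694263, 849826, 800667, 800667, 1170562, 1158340, 1026790, 1618480,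
   1283926, 1172770, 591657, 1173130, 127041, 1618816, 753033, 709455, 752571, 751689, 753039,
   709461, 752553, 751671, 794811, 796173, 796155, 724341, 795105, 795291, 795273, 724635,
   1547404, 1619332, 1618450, 1619794, 1547410, 1619314, 1618432, 1619800, 1576498, 1576480,
   1533478, 1575136, 1575616, 1575598, 1533772, 1575430, 800571, 799689, 800667, 800667, 800571,
   799689, 800613, 799605, 800613, 800667, 800667, 799605, 800025, 799899, 800025, 799899, 800667,
   800667, 800667, 800667, 800667, 800667, 1624114, 1623232, 1624114, 1623232, 1624156, 800667,
   800667, 1623148, 1624156, 1623148, 1623568, 1623442, 800667, 800667, 1623568, 1623442, 800667,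
   800667, 800571, 799689, 800667, 800667, 800613, 799605, 800613, 918184, 800025, 799899, 800025,
   919360, 800667, 800667, 800667, 800667, 1153522, 1152640, 212625, 1623148, 213507, 1623442,
   800667, 800667, 800667, 800667, 800667, 800667, 710229, 800667, 800667, 240033, 724635, 254439,
   800667, 800667, 800667, 800667, 800667, 800667, 800667, 800667, 1063576, 1533772, 1077982,
   800667, 800667, 1548178, 800667, 800667, 286395, 42963, 709461, 183201, 792459, 239265, 723867,
   379503, 800667, 800667, 800667, 800667, 1111996, 872680, 998512, 1613944, 1068982, 1537120,
   1194814, 800667, 800667, 1553584]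

set_option maxRecDepth 100000 in
lemma collected_seed :
    (collected (allTerms seed) certificates []).all (fun t => t.1 = 0) = true := by
  decide +kernel

lemma traceTotal_seed_ne_zero : traceTotal seed ≠ 0 := by decide +kernel

end Seed

/-- The explicit non-Cartan element `Ξnc(X;ψ)` does not lie in the
super-commuting ideal `I_sc`; equivalently, it defines a nonzero element of the
coordinate ring `O(C^{3|2}_{so₇}) = S/I_sc` of the super-commuting scheme of
`3|2`-tuples for `so₇`. -/
theorem XiNC_not_mem_Isc :
    XiNC (R := ℂ) Xgen psiGen ∉ Isc :=
  not_mem_Isc_of_certificates seed certificates (by decide) collected_seed traceTotal_seed_ne_zero
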